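/- In the clipping ANN setting, assume that f is non-decreasing and satisfies Lip(f) < min_{i ∈ {1,…,h}} v_i w_i, let ϑ ∈ ℝ^{h+1} satisfy (∇L)(ϑ) = 0, and let V = sup_{x ∈ (a,b)} Σ_{i ∈ {1,…,h}, x ∈ I_i^ϑ} v_i. Then max{ N^ϑ(b) − f(b), f(a) − N^ϑ(a) } ≤ V. -/

import Mathlib

open MeasureTheory Filter

noncomputable section

/-- The clipping function `x ↦ min{max{x,0},1}`. -/
def clipFn (x : ℝ) : ℝ := min (max x 0) 1

/-- `ψ_i(θ) = -θ_i / w_i`. -/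
def psiC {h : ℕ} (w : Fin h → ℝ) (θ : Fin (h + 1) → ℝ) (i : Fin h) : ℝ :=
  -θ i.castSucc / w i

/-- The activity interval `I_i^θ = (ψ_i(θ), ψ_i(θ) + 1/w_i) ∩ (a, b)`. -/
def actI {h : ℕ} (a b : ℝ) (w : Fin h → ℝ) (θ : Fin (h + 1) → ℝ) (i : Fin h) : Set ℝ :=
  Set.Ioo (psiC w θ i) (psiC w θ i + (w i)⁻¹) ∩ Set.Ioo a b

/-- The realization function `N^θ(x) = θ_{h+1} + ∑_i v_i c(w_i x + θ_i)`. -/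
def realC {h : ℕ} (v w : Fin h → ℝ) (θ : Fin (h + 1) → ℝ) (x : ℝ) : ℝ :=
  θ (Fin.last h) + ∑ i : Fin h, v i * clipFn (w i * x + θ i.castSucc)

/-- The risk `L(θ) = ∫_a^b (N^θ(x) - f(x))² p(x) dx`. -/
def riskC {h : ℕ} (a b : ℝ) (v w : Fin h → ℝ) (f p : ℝ → ℝ) (θ : Fin (h + 1) → ℝ) : ℝ :=
  ∫ x in Set.Ioo a b, (realC v w θ x - f x) ^ 2 * p x

/-- The gradient `∇L(θ)` as a vector of partial derivatives. -/
def gradC {h : ℕ} (a b : ℝ) (v w : Fin h → ℝ) (f p : ℝ → ℝ) (θ : Fin (h + 1) → ℝ) :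
    Fin (h + 1) → ℝ :=
  fun k => fderiv ℝ (riskC a b v w f p) θ (Pi.single k 1)

/-- `x` is a descending critical point of `g` : `∇g(x) = 0` and the Hessian quadratic form
admits a negative value. -/
def IsDescCrit {n : ℕ} (g : (Fin n → ℝ) → ℝ) (x : Fin n → ℝ) : Prop :=
  fderiv ℝ g x = 0 ∧ ∃ u : Fin n → ℝ, iteratedFDeriv ℝ 2 g x ![u, u] < 0

/-- The Euclidean norm on `Fin n → ℝ`. -/
def euclNorm {n : ℕ} (x : Fin n → ℝ) : ℝ := Real.sqrt (∑ i, (x i) ^ 2)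

/-- Piecewise polynomial functions. -/
def PiecewisePoly (F : ℝ → ℝ) : Prop :=
  ∃ (K : ℕ) (τ : ℕ → EReal), 0 < K ∧ τ 0 = ⊥ ∧ τ K = ⊤ ∧
    (∀ k, k < K → τ k < τ (k + 1)) ∧
    ∀ k, k < K → ∃ q : Polynomial ℝ, ∀ x : ℝ,
      τ k < (x : EReal) → (x : EReal) < τ (k + 1) → F x = q.eval x

lemma continuous_clipFn : Continuous clipFn := by
  unfold clipFn; fun_prop

lemma clipFn_nonneg (x : ℝ) : 0 ≤ clipFn x := by simp [clipFn]

lemma clipFn_le_one (x : ℝ) : clipFn x ≤ 1 := by simp [clipFn]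

lemma clipFn_of_nonpos {x : ℝ} (hx : x ≤ 0) : clipFn x = 0 := by simp [clipFn, hx]

lemma clipFn_of_one_le {x : ℝ} (hx : 1 ≤ x) : clipFn x = 1 := by
  simp [clipFn, hx]

lemma clipFn_of_mem_Icc {x : ℝ} (hx : x ∈ Set.Icc (0 : ℝ) 1) : clipFn x = x := by
  simp [clipFn, hx.1, hx.2]

lemma abs_clipFn_sub_le (x y : ℝ) : |clipFn x - clipFn y| ≤ |x - y| :=
  (abs_min_sub_min_le_max (max x 0) 1 (max y 0) 1).trans <| by
    simpa using abs_max_sub_max_le_max x 0 y 0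

/-- The derivative of `clipFn` away from its two kinks. -/
def clipDeriv : ℝ → ℝ := (Set.Ioo 0 1).indicator 1

lemma measurable_clipDeriv : Measurable clipDeriv :=
  measurable_one.indicator measurableSet_Ioo

lemma hasDerivAt_clipFn {x : ℝ} (h0 : x ≠ 0) (h1 : x ≠ 1) :
    HasDerivAt clipFn (clipDeriv x) x := by
  rcases lt_or_gt_of_ne h0 with hx | hx
  · have hd : clipDeriv x = 0 := Set.indicator_of_notMem (fun hm => hx.not_gt hm.1) _
    rw [hd]
    refine (hasDerivAt_const x (0 : ℝ)).congr_of_eventuallyEq ?_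
    filter_upwards [eventually_lt_nhds hx] with y hy using clipFn_of_nonpos hy.le
  rcases lt_or_gt_of_ne h1 with hx' | hx'
  · have hd : clipDeriv x = 1 := Set.indicator_of_mem (s := Set.Ioo 0 1) ⟨hx, hx'⟩ _
    rw [hd]
    refine (hasDerivAt_id x).congr_of_eventuallyEq ?_
    filter_upwards [Ioo_mem_nhds hx hx'] with y hy using
      clipFn_of_mem_Icc (Set.Ioo_subset_Icc_self hy)
  · have hd : clipDeriv x = 0 := Set.indicator_of_notMem (fun hm => hx'.not_gt hm.2) _
    rw [hd]
    refine (hasDerivAt_const x (1 : ℝ)).congr_of_eventuallyEq ?_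
    filter_upwards [eventually_gt_nhds hx'] with y hy using clipFn_of_one_le hy.le

section Network

variable {h : ℕ} {v w : Fin h → ℝ}

lemma continuous_realC (θ : Fin (h + 1) → ℝ) : Continuous (realC v w θ) := by
  have := continuous_clipFn
  unfold realC
  fun_prop

lemma abs_realC_sub_le (hv : ∀ i, 0 < v i) (θ η : Fin (h + 1) → ℝ) (x : ℝ) :
    |realC v w θ x - realC v w η x| ≤ (1 + ∑ i, v i) * ‖θ - η‖ := by
  have hcoord : ∀ k, |θ k - η k| ≤ ‖θ - η‖ := fun k => norm_le_pi_norm (θ - η) k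
  have heq : realC v w θ x - realC v w η x = (θ (Fin.last h) - η (Fin.last h)) +
      ∑ i, v i * (clipFn (w i * x + θ i.castSucc) - clipFn (w i * x + η i.castSucc)) := by
    simp only [realC, mul_sub, Finset.sum_sub_distrib]
    ring
  rw [heq, add_mul, one_mul, Finset.sum_mul]
  refine (abs_add_le _ _).trans (add_le_add (hcoord _) ?_)
  refine (Finset.abs_sum_le_sum_abs _ _).trans (Finset.sum_le_sum fun i _ => ?_)
  rw [abs_mul, abs_of_pos (hv i)]
  refine mul_le_mul_of_nonneg_left ((abs_clipFn_sub_le _ _).trans ?_) (hv i).le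
  simpa using hcoord i.castSucc

lemma abs_realC_le (hv : ∀ i, 0 < v i) (θ : Fin (h + 1) → ℝ) (x : ℝ) :
    |realC v w θ x| ≤ |θ (Fin.last h)| + ∑ i, v i := by
  refine (abs_add_le _ _).trans (add_le_add_right ?_ _)
  rw [abs_of_nonneg (Finset.sum_nonneg fun i _ => mul_nonneg (hv i).le (clipFn_nonneg _))]
  exact Finset.sum_le_sum fun i _ => mul_le_of_le_one_right (hv i).le (clipFn_le_one _)

/-- The derivative of `θ ↦ realC v w θ x` at parameters for which `x` is not a kink. -/
def realDeriv (v w : Fin h → ℝ) (θ : Fin (h + 1) → ℝ) (x : ℝ) : (Fin (h + 1) → ℝ) →L[ℝ] ℝ :=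
  ContinuousLinearMap.proj (Fin.last h) +
    ∑ i : Fin h, (v i * clipDeriv (w i * x + θ i.castSucc)) •
      (ContinuousLinearMap.proj i.castSucc : (Fin (h + 1) → ℝ) →L[ℝ] ℝ)

lemma hasFDerivAt_realC {θ : Fin (h + 1) → ℝ} {x : ℝ}
    (hx : ∀ i : Fin h, w i * x + θ i.castSucc ≠ 0 ∧ w i * x + θ i.castSucc ≠ 1) :
    HasFDerivAt (fun η => realC v w η x) (realDeriv v w θ x) θ := by
  unfold realC realDeriv
  refine (hasFDerivAt_apply (𝕜 := ℝ) (Fin.last h) θ).add (HasFDerivAt.fun_sum fun i _ => ?_)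
  have h1 : HasFDerivAt (fun η : Fin (h + 1) → ℝ => w i * x + η i.castSucc)
      (ContinuousLinearMap.proj i.castSucc : (Fin (h + 1) → ℝ) →L[ℝ] ℝ) θ :=
    (hasFDerivAt_apply (𝕜 := ℝ) i.castSucc θ).const_add _
  have h2 := ((hasDerivAt_clipFn (hx i).1 (hx i).2).comp_hasFDerivAt θ h1).const_mul (v i)
  rwa [smul_smul] at h2

lemma ae_ne_kink (hw : ∀ i, 0 < w i) (θ : Fin (h + 1) → ℝ) :
    ∀ᵐ x : ℝ, ∀ i : Fin h, w i * x + θ i.castSucc ≠ 0 ∧ w i * x + θ i.castSucc ≠ 1 := by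
  refine ae_all_iff.2 fun i => ?_
  have hne := (hw i).ne'
  filter_upwards [Measure.ae_ne volume (-θ i.castSucc / w i),
    Measure.ae_ne volume ((1 - θ i.castSucc) / w i)] with x h0 h1
  constructor
  · intro hx
    exact h0 (by rw [eq_div_iff hne]; linarith)
  · intro hx
    exact h1 (by rw [eq_div_iff hne]; linarith)

lemma measurable_clipDeriv_comp (θ : Fin (h + 1) → ℝ) (i : Fin h) :
    Measurable fun x => clipDeriv (w i * x + θ i.castSucc) :=
  measurable_clipDeriv.comp (by fun_prop)

/-- The derivative of the risk, together with integrability of the integrand. -/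
lemma hasFDerivAt_riskC {a b : ℝ} (hv : ∀ i, 0 < v i) (hw : ∀ i, 0 < w i) {f p : ℝ → ℝ}
    (hf : Continuous f) (hp : Continuous p) (hpnn : ∀ x, 0 ≤ p x) (θ : Fin (h + 1) → ℝ) :
    IntegrableOn (fun x => (2 * (realC v w θ x - f x) * p x) • realDeriv v w θ x)
        (Set.Ioo a b) ∧
      HasFDerivAt (riskC a b v w f p)
        (∫ x in Set.Ioo a b, (2 * (realC v w θ x - f x) * p x) • realDeriv v w θ x) θ := by
  have hint : ∀ {g : ℝ → ℝ}, Continuous g → IntegrableOn g (Set.Ioo a b) := fun hg =>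
    hg.integrableOn_Icc.mono_set Set.Ioo_subset_Icc_self
  have hcont : ∀ η, Continuous fun x => (realC v w η x - f x) ^ 2 * p x := fun η => by
    have := continuous_realC (v := v) (w := w) η
    fun_prop
  set S := ∑ i, v i with hS
  have hS0 : 0 ≤ S := Finset.sum_nonneg fun i _ => (hv i).le
  refine hasFDerivAt_integral_of_dominated_loc_of_lip
    (bound := fun x => (1 + S) * (2 * (|θ (Fin.last h)| + 1 + S + |f x|)) * p x)
    (Metric.ball_mem_nhds θ one_pos) ?_ (hint (hcont θ)) ?_ ?_ ?_ ?_
  · exact Eventually.of_forall fun η => (hcont η).aestronglyMeasurable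
  · refine AEStronglyMeasurable.smul (f := fun x => 2 * (realC v w θ x - f x) * p x)
      (g := realDeriv v w θ) ?_ (AEStronglyMeasurable.add (f := fun _ =>
        (ContinuousLinearMap.proj (Fin.last h) : (Fin (h + 1) → ℝ) →L[ℝ] ℝ)) ?_ ?_)
    · have := continuous_realC (v := v) (w := w) θ
      exact Continuous.aestronglyMeasurable (by fun_prop)
    · exact aestronglyMeasurable_const
    · refine Finset.aestronglyMeasurable_fun_sum _ fun i _ => ?_
      exact AEStronglyMeasurable.smul
        ((measurable_clipDeriv_comp θ i).const_mul _).aestronglyMeasurable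
        aestronglyMeasurable_const
  · refine Eventually.of_forall fun x => ?_
    have hbd : 0 ≤ (1 + S) * (2 * (|θ (Fin.last h)| + 1 + S + |f x|)) * p x := by
      have := hpnn x
      positivity
    refine LipschitzOnWith.of_dist_le_mul fun η hη ζ hζ => ?_
    have hN : ∀ ξ ∈ Metric.ball θ 1,
        |realC v w ξ x - f x| ≤ |θ (Fin.last h)| + 1 + S + |f x| := fun ξ hξ => by
      have h1 := abs_realC_le (w := w) hv ξ x
      have h2 : |ξ (Fin.last h) - θ (Fin.last h)| ≤ 1 :=
        (norm_le_pi_norm (ξ - θ) _).trans (by rw [← dist_eq_norm]; exact (Metric.mem_ball.1 hξ).le)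
      have h3 := abs_sub_abs_le_abs_sub (ξ (Fin.last h)) (θ (Fin.last h))
      have h4 := abs_sub (realC v w ξ x) (f x)
      linarith
    have hL := abs_realC_sub_le (w := w) hv η ζ x
    have hsum : |(realC v w η x - f x) + (realC v w ζ x - f x)| ≤
        2 * (|θ (Fin.last h)| + 1 + S + |f x|) :=
      (abs_add_le _ _).trans (by linarith [hN η hη, hN ζ hζ])
    rw [Real.coe_nnabs, abs_of_nonneg hbd, Real.dist_eq, dist_eq_norm]
    have heq : (realC v w η x - f x) ^ 2 * p x - (realC v w ζ x - f x) ^ 2 * p x =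
        (realC v w η x - realC v w ζ x) *
          ((realC v w η x - f x) + (realC v w ζ x - f x)) * p x := by ring
    rw [heq, abs_mul, abs_mul, abs_of_nonneg (hpnn x)]
    calc _ ≤ ((1 + S) * ‖η - ζ‖) * (2 * (|θ (Fin.last h)| + 1 + S + |f x|)) * p x :=
          mul_le_mul_of_nonneg_right (mul_le_mul hL hsum (abs_nonneg _) (by positivity)) (hpnn x)
      _ = _ := by ring
  · exact hint (by fun_prop)
  · filter_upwards [ae_restrict_of_ae (ae_ne_kink hw θ)] with x hx
    have h1 := (((hasFDerivAt_realC (v := v) hx).sub_const (f x)).pow 2).mul_const (p x)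
    refine h1.congr_fderiv ?_
    rw [smul_smul]
    congr 1
    simp
    ring

lemma integral_eq_zero_of_fderiv_riskC_eq_zero {a b : ℝ} (hv : ∀ i, 0 < v i)
    (hw : ∀ i, 0 < w i) {f p : ℝ → ℝ} (hf : Continuous f) (hp : Continuous p)
    (hpnn : ∀ x, 0 ≤ p x) {θ : Fin (h + 1) → ℝ} (hcrit : fderiv ℝ (riskC a b v w f p) θ = 0)
    (u : Fin (h + 1) → ℝ) :
    ∫ x in Set.Ioo a b, 2 * (realC v w θ x - f x) * p x * realDeriv v w θ x u = 0 := by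
  obtain ⟨hI, hD⟩ := hasFDerivAt_riskC (a := a) (b := b) hv hw hf hp hpnn θ
  have h1 := ContinuousLinearMap.integral_apply hI u
  rw [← hD.fderiv, hcrit] at h1
  simpa using h1.symm

lemma mem_actI_iff {a b : ℝ} (hw : ∀ i, 0 < w i) {θ : Fin (h + 1) → ℝ} {i : Fin h} {x : ℝ} :
    x ∈ actI a b w θ i ↔ w i * x + θ i.castSucc ∈ Set.Ioo 0 1 ∧ x ∈ Set.Ioo a b := by
  have h1 : psiC w θ i < x ↔ 0 < w i * x + θ i.castSucc := by
    rw [psiC, div_lt_iff₀ (hw i)]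
    constructor <;> intro <;> linarith
  have h2 : x < psiC w θ i + (w i)⁻¹ ↔ w i * x + θ i.castSucc < 1 := by
    rw [psiC, ← one_div, ← add_div, lt_div_iff₀ (hw i)]
    constructor <;> intro <;> linarith
  simp only [actI, Set.mem_inter_iff, Set.mem_Ioo, h1, h2]

end Network

/-- A continuous function whose weighted integral over a nonempty open interval vanishes has a
zero in that interval. -/
lemma exists_zero_of_setIntegral_mul_eq_zero {s : Set ℝ} (hs : IsOpen s) (hne : s.Nonempty)
    (hc : IsPreconnected s) {g p : ℝ → ℝ} (hg : Continuous g)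
    (hpos : ∀ x ∈ s, 0 < p x) (hint : IntegrableOn (fun x => g x * p x) s)
    (h0 : ∫ x in s, g x * p x = 0) : ∃ z ∈ s, g z = 0 := by
  by_contra! hz
  have key : ∀ q : ℝ → ℝ, (∀ x ∈ s, 0 < q x) → IntegrableOn q s → ∫ x in s, q x ≠ 0 := by
    intro q hq hqi
    refine ne_of_gt ((setIntegral_pos_iff_support_of_nonneg_ae
      ((ae_restrict_iff' hs.measurableSet).2 (Eventually.of_forall fun x hx => (hq x hx).le))
      hqi).2 ?_)
    rw [Set.inter_eq_right.2 (show s ⊆ Function.support q from fun x hx => (hq x hx).ne')]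
    exact hs.measure_pos volume hne
  by_cases hsign : ∀ x ∈ s, 0 < g x
  · exact key _ (fun x hx => mul_pos (hsign x hx) (hpos x hx)) hint h0
  push Not at hsign
  obtain ⟨x, hx, hgx⟩ := hsign
  refine key (fun x => -(g x * p x)) (fun y hy => ?_) hint.neg ?_
  · by_contra! hle
    have hgy : 0 ≤ g y := nonneg_of_mul_nonneg_left (by linarith) (hpos y hy)
    obtain ⟨z, hzs, hz0⟩ := hc.intermediate_value hx hy hg.continuousOn ⟨hgx, hgy⟩
    exact hz z hzs hz0
  · rw [integral_neg, h0, neg_zero]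

section Critical

variable {h : ℕ} {v w : Fin h → ℝ} {a b : ℝ} {f p : ℝ → ℝ} {θ : Fin (h + 1) → ℝ}

lemma exists_zero_of_isCritical (hab : a < b) (hv : ∀ i, 0 < v i) (hw : ∀ i, 0 < w i)
    (hf : Continuous f) (hp : Continuous p) (hpnn : ∀ x, 0 ≤ p x)
    (hpos : ∀ x ∈ Set.Ioo a b, 0 < p x) (hcrit : fderiv ℝ (riskC a b v w f p) θ = 0) :
    ∃ z ∈ Set.Ioo a b, realC v w θ z - f z = 0 := by
  have hN := continuous_realC (v := v) (w := w) θ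
  refine exists_zero_of_setIntegral_mul_eq_zero isOpen_Ioo (Set.nonempty_Ioo.2 hab)
    isPreconnected_Ioo (hN.sub hf) hpos
    ((Continuous.integrableOn_Icc (by fun_prop)).mono_set Set.Ioo_subset_Icc_self) ?_
  have h1 := integral_eq_zero_of_fderiv_riskC_eq_zero hv hw hf hp hpnn hcrit
    (Pi.single (Fin.last h) 1)
  have h2 : ∀ x, realDeriv v w θ x (Pi.single (Fin.last h) 1) = 1 := fun x => by
    simp [realDeriv]
  simp only [h2, mul_one, mul_assoc, integral_const_mul] at h1
  simpa using h1

lemma exists_zero_mem_actI_of_isCritical (hv : ∀ i, 0 < v i) (hw : ∀ i, 0 < w i)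
    (hf : Continuous f) (hp : Continuous p) (hpnn : ∀ x, 0 ≤ p x)
    (hpos : ∀ x ∈ Set.Ioo a b, 0 < p x) (hcrit : fderiv ℝ (riskC a b v w f p) θ = 0)
    {i : Fin h} (hne : (actI a b w θ i).Nonempty) :
    ∃ z ∈ actI a b w θ i, realC v w θ z - f z = 0 := by
  have hN := continuous_realC (v := v) (w := w) θ
  have hsub : actI a b w θ i ⊆ Set.Ioo a b := Set.inter_subset_right
  have hopen : IsOpen (actI a b w θ i) := isOpen_Ioo.inter isOpen_Ioo
  refine exists_zero_of_setIntegral_mul_eq_zero hopen hne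
    (Set.ordConnected_Ioo.inter Set.ordConnected_Ioo).isPreconnected (hN.sub hf)
    (fun x hx => hpos x (hsub hx)) ((Continuous.integrableOn_Icc (by fun_prop)).mono_set
      (hsub.trans Set.Ioo_subset_Icc_self)) ?_
  have h1 := integral_eq_zero_of_fderiv_riskC_eq_zero hv hw hf hp hpnn hcrit
    (Pi.single i.castSucc 1)
  have h2 : ∀ x ∈ Set.Ioo a b, 2 * (realC v w θ x - f x) * p x *
      realDeriv v w θ x (Pi.single i.castSucc 1) = (2 * v i) *
        (actI a b w θ i).indicator (fun x => (realC v w θ x - f x) * p x) x := fun x hx => by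
    have h3 : realDeriv v w θ x (Pi.single i.castSucc 1) =
        v i * clipDeriv (w i * x + θ i.castSucc) := by
      simp [realDeriv, Pi.single_apply,
        (Fin.castSucc_ne_last i).symm]
    rw [h3]
    by_cases hm : x ∈ actI a b w θ i
    · rw [Set.indicator_of_mem hm, clipDeriv, Set.indicator_of_mem ((mem_actI_iff hw).1 hm).1]
      simp only [Pi.one_apply]
      ring
    · rw [Set.indicator_of_notMem hm, clipDeriv,
        Set.indicator_of_notMem fun hm' => hm ((mem_actI_iff hw).2 ⟨hm', hx⟩)]
      ring
  rw [setIntegral_congr_fun measurableSet_Ioo h2, integral_const_mul,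
    setIntegral_indicator hopen.measurableSet, Set.inter_eq_right.2 hsub] at h1
  simpa [(hv i).ne'] using h1

/-- If all neurons active on `(x, y)` lie in `A`, the realization function increases by at most
the total height of the neurons in `A`. -/
lemma realC_sub_le (hv : ∀ i, 0 < v i) (hw : ∀ i, 0 < w i) {x y c : ℝ} (hax : a ≤ x)
    (hxy : x ≤ y) (hyb : y ≤ b)
    (hact : ∀ i, (actI a b w θ i ∩ Set.Ioo x y).Nonempty → c ∈ actI a b w θ i) :
    realC v w θ y - realC v w θ x ≤ ∑ i, (actI a b w θ i).indicator (fun _ => v i) c := by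
  have heq : realC v w θ y - realC v w θ x =
      ∑ i, v i * (clipFn (w i * y + θ i.castSucc) - clipFn (w i * x + θ i.castSucc)) := by
    simp only [realC, mul_sub, Finset.sum_sub_distrib]
    ring
  rw [heq]
  refine Finset.sum_le_sum fun i _ => ?_
  by_cases hc : c ∈ actI a b w θ i
  · rw [Set.indicator_of_mem hc]
    exact mul_le_of_le_one_right (hv i).le (by
      linarith [clipFn_le_one (w i * y + θ i.castSucc), clipFn_nonneg (w i * x + θ i.castSucc)])
  rw [Set.indicator_of_notMem hc]
  have hem : ¬ (actI a b w θ i ∩ Set.Ioo x y).Nonempty := fun hn => hc (hact i hn)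
  have hwi := hw i
  rcases hxy.eq_or_lt with rfl | hlt
  · simp
  suffices w i * y + θ i.castSucc ≤ 0 ∨ 1 ≤ w i * x + θ i.castSucc by
    rcases this with hy | hx
    · have hx : w i * x + θ i.castSucc ≤ 0 := by nlinarith
      simp [clipFn_of_nonpos hx, clipFn_of_nonpos hy]
    · have hy : 1 ≤ w i * y + θ i.castSucc := by nlinarith
      simp [clipFn_of_one_le hx, clipFn_of_one_le hy]
  by_contra! hcon
  have hlt' : max (w i * x + θ i.castSucc) 0 < min (w i * y + θ i.castSucc) 1 := by
    have : w i * x < w i * y := mul_lt_mul_of_pos_left hlt hwi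
    simp only [max_lt_iff, lt_min_iff]
    refine ⟨⟨by linarith, hcon.1⟩, hcon.2, one_pos⟩
  obtain ⟨m, hm1, hm2⟩ := exists_between hlt'
  rw [max_lt_iff] at hm1
  rw [lt_min_iff] at hm2
  have hmw : w i * ((m - θ i.castSucc) / w i) = m - θ i.castSucc := by
    field_simp
  have hx' : x < (m - θ i.castSucc) / w i := by
    rw [lt_div_iff₀ hwi]; linarith [mul_comm x (w i)]
  have hy' : (m - θ i.castSucc) / w i < y := by
    rw [div_lt_iff₀ hwi]; linarith [mul_comm y (w i)]
  refine hem ⟨(m - θ i.castSucc) / w i, (mem_actI_iff hw).2 ⟨?_, ?_⟩, hx', hy'⟩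
  · rw [hmw]
    constructor <;> linarith
  · exact ⟨hax.trans_lt hx', hy'.trans_le hyb⟩

end Critical

theorem statement_8
    (a b : ℝ) (hab : a < b) (h : ℕ) (hh : 0 < h)
    (v w : Fin h → ℝ) (hv : ∀ i, 0 < v i) (hw : ∀ i, 0 < w i)
    (f p : ℝ → ℝ) (hf : Continuous f) (hp : Continuous p)
    (hpnn : ∀ x : ℝ, 0 ≤ p x) (hsupp : {x : ℝ | 0 < p x} = Set.Ioo a b)
    (hfmono : Monotone f)
    -- `Lip(f) < min_i v_i w_i`
    (K : ℝ) (hK : ∀ i, K < v i * w i)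
    (hLipf : ∀ x ∈ Set.Icc a b, ∀ y ∈ Set.Icc a b, |f x - f y| ≤ K * |x - y|)
    (ϑ : Fin (h + 1) → ℝ) (hcrit : fderiv ℝ (riskC a b v w f p) ϑ = 0)
    (V : ℝ)
    (hV : V = sSup ((fun x => ∑ i : Fin h, (actI a b w ϑ i).indicator (fun _ => v i) x) ''
      Set.Ioo a b)) :
    max (realC v w ϑ b - f b) (f a - realC v w ϑ a) ≤ V := by
  have hpos : ∀ x ∈ Set.Ioo a b, 0 < p x := fun x hx => by rwa [← hsupp] at hx
  have hVle : ∀ x ∈ Set.Ioo a b,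
      ∑ i : Fin h, (actI a b w ϑ i).indicator (fun _ => v i) x ≤ V := fun x hx => by
    rw [hV]
    refine le_csSup ⟨∑ i, v i, ?_⟩ (Set.mem_image_of_mem _ hx)
    rintro _ ⟨y, -, rfl⟩
    exact Finset.sum_le_sum fun i _ =>
      Set.indicator_le_self' (fun _ _ => (hv i).le) y
  obtain ⟨z₀, hz₀, hgz₀⟩ := exists_zero_of_isCritical hab hv hw hf hp hpnn hpos hcrit
  have hV0 : 0 ≤ V := (Finset.sum_nonneg fun i _ =>
    Set.indicator_nonneg (fun _ _ => (hv i).le) z₀).trans (hVle z₀ hz₀)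
  have hzero : ∀ i, (actI a b w ϑ i).Nonempty →
      ∃ z ∈ actI a b w ϑ i, realC v w ϑ z - f z = 0 := fun i hne =>
    exists_zero_mem_actI_of_isCritical hv hw hf hp hpnn hpos hcrit hne
  have hord : ∀ i, (actI a b w ϑ i).OrdConnected := fun i =>
    Set.ordConnected_Ioo.inter Set.ordConnected_Ioo
  have hcont : Continuous fun x => realC v w ϑ x - f x := (continuous_realC ϑ).sub hf
  have hZ : IsCompact (Set.Icc a b ∩ {x | realC v w ϑ x - f x = 0}) :=
    isCompact_Icc.inter_right (isClosed_singleton.preimage hcont)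
  have hZne : (Set.Icc a b ∩ {x | realC v w ϑ x - f x = 0}).Nonempty :=
    ⟨z₀, Set.Ioo_subset_Icc_self hz₀, hgz₀⟩
  refine max_le ?_ ?_
  · obtain ⟨z, ⟨hz, hgz⟩, hmax⟩ := hZ.exists_isGreatest hZne
    have hgz : realC v w ϑ z - f z = 0 := hgz
    have haz : a < z := hz₀.1.trans_le (hmax ⟨Set.Ioo_subset_Icc_self hz₀, hgz₀⟩)
    rcases hz.2.eq_or_lt with rfl | hzb
    · linarith
    have hN := realC_sub_le hv hw (θ := ϑ) (c := z) haz.le hzb.le le_rfl fun i hi => by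
      obtain ⟨y, hy, hzy⟩ := hi
      obtain ⟨t, ht, hgt⟩ := hzero i ⟨y, hy⟩
      exact (hord i).out ht hy ⟨hmax ⟨Set.Ioo_subset_Icc_self ht.2, hgt⟩, hzy.1.le⟩
    linarith [hVle z ⟨haz, hzb⟩, hfmono hzb.le]
  · obtain ⟨z, ⟨hz, hgz⟩, hmin⟩ := hZ.exists_isLeast hZne
    have hgz : realC v w ϑ z - f z = 0 := hgz
    have hzb : z < b := (hmin ⟨Set.Ioo_subset_Icc_self hz₀, hgz₀⟩).trans_lt hz₀.2
    rcases hz.1.eq_or_lt with rfl | haz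
    · linarith
    have hN := realC_sub_le hv hw (θ := ϑ) (c := z) le_rfl haz.le hzb.le fun i hi => by
      obtain ⟨y, hy, hzy⟩ := hi
      obtain ⟨t, ht, hgt⟩ := hzero i ⟨y, hy⟩
      exact (hord i).out hy ht ⟨hzy.2.le, hmin ⟨Set.Ioo_subset_Icc_self ht.2, hgt⟩⟩
    linarith [hVle z ⟨haz, hzb⟩, hfmono haz.le]
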